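/- Let (L, [·,·], α, β) be a BiHom-Lie superalgebra. Then the free ℤ₂-graded ℂ[∂]-module R = ℂ[∂] ⊗ L, with λ-bracket determined by [u_λ v] = [u, v] for u, v ∈ L (extended by conformal sesquilinearity) and with α(f(∂) ⊗ u) = f(∂) ⊗ α(u), β(f(∂) ⊗ u) = f(∂) ⊗ β(u), is a BiHom-Lie conformal superalgebra. -/

import Mathlib

/- ## Conventions

A (ℤ₂-graded) `ℂ[∂]`-module is a complex vector space `R` together with
`D : Module.End ℂ R` (the action of `∂`) and a grading `G : ZMod 2 → Submodule ℂ R`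
which is an internal direct sum decomposition.

A `λ`-bracket `R ⊗ R → ℂ[λ] ⊗ R` is encoded by its coefficients:
`br : ℕ → R → R → R`, where `[a_λ b] = ∑ₙ λⁿ • br n a b` (a finite sum, by the
`locality` axiom which expresses that the values really lie in `ℂ[λ] ⊗ R`).
All axioms of the various kinds of conformal superalgebras are expressed below by
comparing coefficients of the polynomial identities in `λ` (and `μ`). -/

noncomputable section

open Finset

/-- The super-sign `(-1)^{|i||j|}`. -/
def sgn (i j : ZMod 2) : ℂ := (-1 : ℂ) ^ (i.val * j.val)

/-- `prev g n = g (n-1)`, with the convention that it vanishes for `n = 0`.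
If `g` lists the coefficients of a polynomial `p(λ)`, then `prev g` lists the
coefficients of `λ * p(λ)`. -/
def prev {M : Type*} [Zero M] (g : ℕ → M) : ℕ → M
  | 0 => 0
  | n + 1 => g n

/-- If `g` lists the coefficients of a polynomial `p(λ)` with coefficients in the
`ℂ[∂]`-module `(M, DM)`, then `nsub DM g` lists the coefficients of `p(-λ-∂)`. -/
def nsub {M : Type*} [AddCommGroup M] [Module ℂ M] (DM : Module.End ℂ M)
    (g : ℕ → M) (n : ℕ) : M :=
  ∑ᶠ j : ℕ, (((-1 : ℂ) ^ (n + j)) * ((n + j).choose n : ℂ)) • (DM ^ j) (g (n + j))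

/-- Bilinearity (over `ℂ`) of a `λ`-product with coefficients `br`. -/
structure IsBil {R M : Type*} [AddCommGroup R] [Module ℂ R] [AddCommGroup M] [Module ℂ M]
    (br : ℕ → R → M → M) : Prop where
  add_left : ∀ (n : ℕ) (a b : R) (v : M), br n (a + b) v = br n a v + br n b v
  smul_left : ∀ (n : ℕ) (t : ℂ) (a : R) (v : M), br n (t • a) v = t • br n a v
  add_right : ∀ (n : ℕ) (a : R) (v w : M), br n a (v + w) = br n a v + br n a w
  smul_right : ∀ (n : ℕ) (t : ℂ) (a : R) (v : M), br n a (t • v) = t • br n a v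

/-- A Lie conformal superalgebra structure on the ℤ₂-graded `ℂ[∂]`-module `(R, G, D)` with
`λ`-bracket coefficients `br` (`[a_λ b] = ∑ₙ λⁿ • br n a b`):
conformal sesquilinearity `[(∂a)_λ b] = -λ[a_λ b]`, skew-symmetry
`[a_λ b] = -(-1)^{|a||b|} [b_{-λ-∂} a]` and the Jacobi identity
`[a_λ [b_μ c]] = [[a_λ b]_{λ+μ} c] + (-1)^{|a||b|} [b_μ [a_λ c]]`,
all written out in coefficients of `λ^n μ^m`. -/
structure IsLieConfSuperAlg {R : Type*} [AddCommGroup R] [Module ℂ R]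
    (G : ZMod 2 → Submodule ℂ R) (D : Module.End ℂ R) (br : ℕ → R → R → R) : Prop where
  internal : DirectSum.IsInternal G
  der_even : ∀ (i : ZMod 2) (a : R), a ∈ G i → D a ∈ G i
  bil : IsBil br
  grade : ∀ (i j : ZMod 2) (n : ℕ) (a b : R), a ∈ G i → b ∈ G j → br n a b ∈ G (i + j)
  locality : ∀ a b, ∃ N, ∀ n ≥ N, br n a b = 0
  sesq : ∀ (n : ℕ) (a b : R), br n (D a) b = - prev (fun m => br m a b) n
  skew : ∀ (i j : ZMod 2) (n : ℕ) (a b : R), a ∈ G i → b ∈ G j →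
    br n a b = -(sgn i j) • nsub D (fun m => br m b a) n
  jacobi : ∀ (i j : ZMod 2) (m n : ℕ) (a b c : R), a ∈ G i → b ∈ G j →
    br m a (br n b c) =
      (∑ s ∈ range (m + 1), (((n + s).choose s : ℂ)) • br (n + s) (br (m - s) a b) c)
      + sgn i j • br n b (br m a c)

/-- A BiHom-Lie conformal superalgebra structure on `(R, G, D)` with structure maps
`al`, `be` and `λ`-bracket coefficients `br`. The axioms are those of the definition:
`α∂ = ∂α`, `β∂ = ∂β`, `α` and `β` commute, are even, and preserve the bracket;
conformal sesquilinearity `[(∂a)_λ b] = -λ[a_λ b]`, `[a_λ (∂b)] = (∂+λ)[a_λ b]`;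
BiHom-skew-symmetry `[β(a)_λ α(b)] = -(-1)^{|a||b|} [β(b)_{-λ-∂} α(a)]`; and the
BiHom-Jacobi identity
`[αβ(a)_λ [b_μ c]] = [[β(a)_λ b]_{λ+μ} β(c)] + (-1)^{|a||b|} [β(b)_μ [α(a)_λ c]]`,
written out in coefficients. -/
structure IsBiHomLieConfSuperAlg {R : Type*} [AddCommGroup R] [Module ℂ R]
    (G : ZMod 2 → Submodule ℂ R) (D : Module.End ℂ R)
    (al be : Module.End ℂ R) (br : ℕ → R → R → R) : Prop where
  internal : DirectSum.IsInternal G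
  der_even : ∀ (i : ZMod 2) (a : R), a ∈ G i → D a ∈ G i
  al_even : ∀ (i : ZMod 2) (a : R), a ∈ G i → al a ∈ G i
  be_even : ∀ (i : ZMod 2) (a : R), a ∈ G i → be a ∈ G i
  al_be_comm : ∀ a, al (be a) = be (al a)
  al_der : ∀ a, al (D a) = D (al a)
  be_der : ∀ a, be (D a) = D (be a)
  bil : IsBil br
  grade : ∀ (i j : ZMod 2) (n : ℕ) (a b : R), a ∈ G i → b ∈ G j → br n a b ∈ G (i + j)
  locality : ∀ a b, ∃ N, ∀ n ≥ N, br n a b = 0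
  al_br : ∀ (n : ℕ) (a b : R), al (br n a b) = br n (al a) (al b)
  be_br : ∀ (n : ℕ) (a b : R), be (br n a b) = br n (be a) (be b)
  sesq₁ : ∀ (n : ℕ) (a b : R), br n (D a) b = - prev (fun m => br m a b) n
  sesq₂ : ∀ (n : ℕ) (a b : R), br n a (D b) = D (br n a b) + prev (fun m => br m a b) n
  skew : ∀ (i j : ZMod 2) (n : ℕ) (a b : R), a ∈ G i → b ∈ G j →
    br n (be a) (al b) = -(sgn i j) • nsub D (fun m => br m (be b) (al a)) n
  jacobi : ∀ (i j : ZMod 2) (m n : ℕ) (a b c : R), a ∈ G i → b ∈ G j →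
    br m (al (be a)) (br n b c) =
      (∑ s ∈ range (m + 1), (((n + s).choose s : ℂ)) • br (n + s) (br (m - s) (be a) b) (be c))
      + sgn i j • br n (be b) (br m (al a) c)

/-- A BiHom-Lie superalgebra structure on the ℤ₂-graded vector space `(L, Gsup)` with
bracket `bkt` and structure maps `al`, `be`: the maps are even, commute, preserve the
bracket, and satisfy BiHom-skew-symmetry `[β(a), α(b)] = −(−1)^{|a||b|}[β(b), α(a)]` and
the BiHom-Jacobi identity
`[αβ(a), [b, c]] = [[β(a), b], β(c)] + (−1)^{|a||b|}[β(b), [α(a), c]]`. -/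
structure IsBiHomLieSuperAlg {L : Type*} [AddCommGroup L] [Module ℂ L]
    (Gsup : ZMod 2 → Submodule ℂ L) (bkt : L → L → L) (al be : Module.End ℂ L) : Prop where
  internal : DirectSum.IsInternal Gsup
  add_left : ∀ (a b c : L), bkt (a + b) c = bkt a c + bkt b c
  smul_left : ∀ (t : ℂ) (a c : L), bkt (t • a) c = t • bkt a c
  add_right : ∀ (a b c : L), bkt a (b + c) = bkt a b + bkt a c
  smul_right : ∀ (t : ℂ) (a c : L), bkt a (t • c) = t • bkt a c
  grade : ∀ (i j : ZMod 2) (a b : L), a ∈ Gsup i → b ∈ Gsup j → bkt a b ∈ Gsup (i + j)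
  al_even : ∀ (i : ZMod 2) (a : L), a ∈ Gsup i → al a ∈ Gsup i
  be_even : ∀ (i : ZMod 2) (a : L), a ∈ Gsup i → be a ∈ Gsup i
  al_be_comm : ∀ a, al (be a) = be (al a)
  al_bkt : ∀ a b, al (bkt a b) = bkt (al a) (al b)
  be_bkt : ∀ a b, be (bkt a b) = bkt (be a) (be b)
  skew : ∀ (i j : ZMod 2) (a b : L), a ∈ Gsup i → b ∈ Gsup j →
    bkt (be a) (al b) = -(sgn i j) • bkt (be b) (al a)
  jacobi : ∀ (i j : ZMod 2) (a b c : L), a ∈ Gsup i → b ∈ Gsup j →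
    bkt (al (be a)) (bkt b c) = bkt (bkt (be a) b) (be c) + sgn i j • bkt (be b) (bkt (al a) c)

open scoped TensorProduct

theorem prev_eventually_zero {R : Type*} [Zero R] {g : ℕ → R} (hg : ∃ N, ∀ m ≥ N, g m = 0) :
    ∃ N, ∀ m ≥ N, prev g m = 0 := by
  obtain ⟨N, hN⟩ := hg
  refine ⟨N + 1, fun m hm => ?_⟩
  obtain ⟨k, rfl⟩ : ∃ k, m = k + 1 := ⟨m - 1, by omega⟩
  exact hN k (by omega)

section LambdaProduct

variable {R : Type*} [AddCommGroup R] [Module ℂ R]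

theorem nsub_eq_sum_range (D : Module.End ℂ R) {g : ℕ → R} {N : ℕ} (hg : ∀ m ≥ N, g m = 0)
    (n : ℕ) {K : ℕ} (hK : N ≤ K) :
    nsub D g n = ∑ j ∈ range K,
      (((-1 : ℂ) ^ (n + j)) * ((n + j).choose n : ℂ)) • (D ^ j) (g (n + j)) := by
  refine finsum_eq_finsetSum_of_support_subset _ fun j hj => ?_
  by_contra hjK
  have : K ≤ j := by simpa using hjK
  exact hj (by simp [hg (n + j) (by omega)])

theorem nsub_add (D : Module.End ℂ R) {g h : ℕ → R} (hg : ∃ N, ∀ m ≥ N, g m = 0)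
    (hh : ∃ N, ∀ m ≥ N, h m = 0) (n : ℕ) :
    nsub D (fun m => g m + h m) n = nsub D g n + nsub D h n := by
  obtain ⟨N, hN⟩ := hg
  obtain ⟨K, hK⟩ := hh
  rw [nsub_eq_sum_range D hN n (le_max_left N K), nsub_eq_sum_range D hK n (le_max_right N K),
    nsub_eq_sum_range D (N := max N K) (fun m hm => by
      rw [hN m (le_trans (le_max_left _ _) hm), hK m (le_trans (le_max_right _ _) hm), add_zero])
      n le_rfl, ← sum_add_distrib]
  simp only [map_add, smul_add]

theorem nsub_smul (D : Module.End ℂ R) (t : ℂ) (g : ℕ → R) (n : ℕ) :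
    nsub D (fun m => t • g m) n = t • nsub D g n := by
  simp only [nsub, map_smul, smul_finsum]
  exact finsum_congr fun j => smul_comm _ _ _

theorem nsub_neg (D : Module.End ℂ R) (g : ℕ → R) (n : ℕ) :
    nsub D (fun m => - g m) n = - nsub D g n := by
  simpa using nsub_smul D (-1) g n

theorem nsub_map (D : Module.End ℂ R) {g : ℕ → R} (hg : ∃ N, ∀ m ≥ N, g m = 0) (n : ℕ) :
    nsub D (fun m => D (g m)) n = D (nsub D g n) := by
  obtain ⟨N, hN⟩ := hg
  rw [nsub_eq_sum_range D hN n le_rfl, nsub_eq_sum_range D (N := N)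
    (fun m hm => by rw [hN m hm, map_zero]) n le_rfl, map_sum]
  refine sum_congr rfl fun j _ => ?_
  rw [map_smul, ← Module.End.mul_apply, ← Module.End.mul_apply, ← pow_succ, ← pow_succ']

/-- Substituting `λ ↦ -λ-∂` in `λ p(λ)` gives `-(λ+∂) p(-λ-∂)`. -/
theorem nsub_prev (D : Module.End ℂ R) {g : ℕ → R} (hg : ∃ N, ∀ m ≥ N, g m = 0) (n : ℕ) :
    nsub D (prev g) n = - D (nsub D g n) - prev (nsub D g) n := by
  obtain ⟨N, hN⟩ := hg
  have hp : ∀ m ≥ N + 1, prev g m = 0 := fun m hm => by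
    obtain ⟨k, rfl⟩ : ∃ k, m = k + 1 := ⟨m - 1, by omega⟩
    exact hN k (by omega)
  rw [nsub_eq_sum_range D hp n le_rfl, nsub_eq_sum_range D hN n le_rfl]
  cases n with
  | zero =>
    rw [sum_range_succ']
    simp only [prev, map_sum, map_smul, ← sum_neg_distrib, sub_zero, zero_add, map_zero,
      smul_zero, add_zero, Nat.choose_zero_right]
    refine sum_congr rfl fun j _ => ?_
    rw [pow_succ' D, Module.End.mul_apply, pow_succ, ← neg_smul]
    rw [mul_neg_one, neg_mul, Nat.add_eq, zero_add]
  | succ n =>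
    change _ = _ - nsub D g n
    rw [nsub_eq_sum_range D hN n (Nat.le_succ N), map_sum]
    have key : ∀ j, (((-1 : ℂ) ^ (n + 1 + j)) * ((n + 1 + j).choose (n + 1) : ℂ)) •
        (D ^ j) (prev g (n + 1 + j)) =
        ((-1 : ℂ) ^ (n + 1 + j) * ((n + j).choose (n + 1) : ℂ)) • (D ^ j) (g (n + j)) -
        ((-1 : ℂ) ^ (n + j) * ((n + j).choose n : ℂ)) • (D ^ j) (g (n + j)) := fun j => by
      have e : n + 1 + j = (n + j) + 1 := by omega
      rw [e, Nat.choose_succ_succ, ← sub_smul]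
      change _ • (D ^ j) (g (n + j)) = _
      congr 1
      push_cast
      ring
    rw [sum_congr rfl fun j _ => key j, sum_sub_distrib, sum_range_succ']
    simp only [add_zero, Nat.choose_succ_self, Nat.cast_zero, mul_zero, zero_smul]
    rw [← sum_neg_distrib]
    congr 1
    refine sum_congr rfl fun j _ => ?_
    have e : n + (j + 1) = n + 1 + j := by omega
    rw [e, pow_succ' D, Module.End.mul_apply, map_smul, ← neg_smul]
    congr 1
    rw [← add_assoc, pow_succ]
    ring

/-- If `F l k` are the coefficients of `p(ν, λ) = ∑ νˡ λᵏ F l k`, then `shiftCoeff F m n` is the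
coefficient of `λᵐ μⁿ` in `p(λ+μ, λ)`. -/
def shiftCoeff (F : ℕ → ℕ → R) (m n : ℕ) : R :=
  ∑ s ∈ range (m + 1), (((n + s).choose s : ℂ)) • F (n + s) (m - s)

theorem shiftCoeff_add (F F' : ℕ → ℕ → R) (m n : ℕ) :
    shiftCoeff (fun l k => F l k + F' l k) m n = shiftCoeff F m n + shiftCoeff F' m n := by
  simp [shiftCoeff, sum_add_distrib]

theorem shiftCoeff_neg (F : ℕ → ℕ → R) (m n : ℕ) :
    shiftCoeff (fun l k => - F l k) m n = - shiftCoeff F m n := by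
  simp [shiftCoeff]

theorem shiftCoeff_smul (t : ℂ) (F : ℕ → ℕ → R) (m n : ℕ) :
    shiftCoeff (fun l k => t • F l k) m n = t • shiftCoeff F m n := by
  simp only [shiftCoeff, smul_sum]
  exact sum_congr rfl fun s _ => smul_comm _ _ _

theorem shiftCoeff_map (D : Module.End ℂ R) (F : ℕ → ℕ → R) (m n : ℕ) :
    shiftCoeff (fun l k => D (F l k)) m n = D (shiftCoeff F m n) := by
  simp [shiftCoeff]

theorem shiftCoeff_prev_right (F : ℕ → ℕ → R) (m n : ℕ) :
    shiftCoeff (fun l k => prev (F l) k) m n = prev (fun m => shiftCoeff F m n) m := by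
  cases m with
  | zero => simp [shiftCoeff, prev]
  | succ m =>
    simp only [shiftCoeff]
    rw [sum_range_succ, Nat.sub_self]
    simp only [prev, smul_zero, add_zero]
    refine sum_congr rfl fun s hs => ?_
    have e : m + 1 - s = (m - s) + 1 := by
      have := mem_range.1 hs
      omega
    rw [e]

/-- Multiplying by `ν` before substituting `ν = λ+μ` is multiplying by `λ+μ` afterwards. -/
theorem shiftCoeff_prev_left (F : ℕ → ℕ → R) (m n : ℕ) :
    shiftCoeff (fun l k => prev (fun l => F l k) l) m n =
      prev (fun m => shiftCoeff F m n) m + prev (shiftCoeff F m) n := by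
  cases n with
  | zero =>
    cases m with
    | zero => simp [shiftCoeff, prev]
    | succ m =>
      simp only [shiftCoeff]
      rw [sum_range_succ']
      simp [prev]
  | succ n =>
    have key : ∀ s, (((n + 1 + s).choose s : ℂ)) • prev (fun l => F l (m - s)) (n + 1 + s) =
        (((n + s + 1).choose s : ℂ)) • F (n + s) (m - s) := fun s => by
      rw [show n + 1 + s = n + s + 1 by omega]
      rfl
    simp only [shiftCoeff, key]
    rw [sum_range_succ']
    change _ = _ + shiftCoeff F m n
    rw [shiftCoeff, sum_range_succ' _ m]
    have key' : ∀ s, (((n + (s + 1) + 1).choose (s + 1) : ℂ)) • F (n + (s + 1)) (m - (s + 1)) =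
        (((n + 1 + s).choose s : ℂ)) • F (n + 1 + s) (m - (s + 1)) +
        (((n + (s + 1)).choose (s + 1) : ℂ)) • F (n + (s + 1)) (m - (s + 1)) := fun s => by
      rw [show n + 1 + s = n + (s + 1) by omega, Nat.choose_succ_succ, ← add_smul]
      push_cast
      rfl
    rw [sum_congr rfl fun s _ => key' s, sum_add_distrib]
    simp only [add_zero, Nat.choose_zero_right, add_assoc]
    congr 1
    cases m with
    | zero => simp [prev]
    | succ m => simp only [prev, Nat.add_sub_add_right]

theorem map_prev {R' : Type*} [AddCommGroup R'] [Module ℂ R'] (f : R →ₗ[ℂ] R') (g : ℕ → R)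
    (n : ℕ) : f (prev g n) = prev (fun m => f (g m)) n := by
  cases n <;> simp [prev]

theorem prev_apply {R' : Type*} [AddCommGroup R'] [Module ℂ R'] (g : ℕ → R →ₗ[ℂ] R') (n : ℕ)
    (x : R) : prev g n x = prev (fun m => g m x) n :=
  map_prev (LinearMap.applyₗ x) g n

/-- Conformal sesquilinearity of a bilinear `λ`-product. -/
structure IsSesq (D : Module.End ℂ R) (B : ℕ → R →ₗ[ℂ] R →ₗ[ℂ] R) : Prop where
  left : ∀ (n : ℕ) (x y : R), B n (D x) y = - prev (fun m => B m x y) n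
  right : ∀ (n : ℕ) (x y : R), B n x (D y) = D (B n x y) + prev (fun m => B m x y) n

variable {D : Module.End ℂ R} {B : ℕ → R →ₗ[ℂ] R →ₗ[ℂ] R}

/-- The BiHom-Jacobi identity for `a`, `b`, `c`, with sign `t`. -/
def JacobiAt (B : ℕ → R →ₗ[ℂ] R →ₗ[ℂ] R) (al be : Module.End ℂ R) (t : ℂ) (a b c : R) : Prop :=
  ∀ m n : ℕ, B m (al (be a)) (B n b c) =
    shiftCoeff (fun l k => B l (B k (be a) b) (be c)) m n + t • B n (be b) (B m (al a) c)

/-- BiHom-skew-symmetry for `a`, `b`, with sign `t`. -/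
def SkewAt (D : Module.End ℂ R) (B : ℕ → R →ₗ[ℂ] R →ₗ[ℂ] R) (al be : Module.End ℂ R) (t : ℂ)
    (a b : R) : Prop :=
  ∀ n : ℕ, B n (be a) (al b) = -t • nsub D (fun m => B m (be b) (al a)) n

namespace JacobiAt

variable {al be : Module.End ℂ R} {t : ℂ} {a a' b b' c c' : R}

theorem add₁ (h : JacobiAt B al be t a b c) (h' : JacobiAt B al be t a' b c) :
    JacobiAt B al be t (a + a') b c := fun m n => by
  simp only [map_add, LinearMap.add_apply, h m n, h' m n, shiftCoeff_add, smul_add]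
  abel

theorem add₂ (h : JacobiAt B al be t a b c) (h' : JacobiAt B al be t a b' c) :
    JacobiAt B al be t a (b + b') c := fun m n => by
  simp only [map_add, LinearMap.add_apply, h m n, h' m n, shiftCoeff_add, smul_add]
  abel

theorem add₃ (h : JacobiAt B al be t a b c) (h' : JacobiAt B al be t a b c') :
    JacobiAt B al be t a b (c + c') := fun m n => by
  simp only [map_add, h m n, h' m n, shiftCoeff_add, smul_add]
  abel

theorem smul₁ (r : ℂ) (h : JacobiAt B al be t a b c) : JacobiAt B al be t (r • a) b c :=
  fun m n => by
  simp only [map_smul, LinearMap.smul_apply, h m n, shiftCoeff_smul, smul_add, smul_comm t r]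

theorem smul₂ (r : ℂ) (h : JacobiAt B al be t a b c) : JacobiAt B al be t a (r • b) c :=
  fun m n => by
  simp only [map_smul, LinearMap.smul_apply, h m n, shiftCoeff_smul, smul_add, smul_comm t r]

theorem smul₃ (r : ℂ) (h : JacobiAt B al be t a b c) : JacobiAt B al be t a b (r • c) :=
  fun m n => by
  simp only [map_smul, h m n, shiftCoeff_smul, smul_add, smul_comm t r]

theorem der₁ (hB : IsSesq D B) (hal : ∀ x, al (D x) = D (al x)) (hbe : ∀ x, be (D x) = D (be x))
    (h : JacobiAt B al be t a b c) : JacobiAt B al be t (D a) b c := fun m n => by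
  simp only [hal, hbe, hB.left, map_neg, LinearMap.neg_apply, prev_apply, shiftCoeff_neg, map_prev,
    shiftCoeff_prev_right (fun l k => B l (B k (be a) b) (be c))]
  cases m with
  | zero => simp [prev]
  | succ m => simp only [prev, h m n, smul_neg, neg_add]

theorem der₂ (hB : IsSesq D B) (hbe : ∀ x, be (D x) = D (be x))
    (h : JacobiAt B al be t a b c) : JacobiAt B al be t a (D b) c := fun m n => by
  simp only [hbe, hB.left, hB.right, map_neg, map_add, LinearMap.add_apply, prev_apply,
    shiftCoeff_neg, shiftCoeff_add, map_prev,
    shiftCoeff_prev_right (fun l k => B l (B k (be a) b) (be c)),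
    shiftCoeff_prev_left (fun l k => B l (B k (be a) b) (be c))]
  cases n with
  | zero => simp [prev]
  | succ n =>
    simp only [prev, h m n, smul_neg]
    abel

theorem der₃ (hB : IsSesq D B) (hbe : ∀ x, be (D x) = D (be x))
    (h : JacobiAt B al be t a b c) : JacobiAt B al be t a b (D c) := fun m n => by
  simp only [hbe, hB.right, map_add, shiftCoeff_add, map_prev, shiftCoeff_map,
    shiftCoeff_prev_left (fun l k => B l (B k (be a) b) (be c)), smul_add, h m n, map_smul]
  cases n <;> cases m <;> simp only [prev, h _ _, smul_zero] <;> abel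

end JacobiAt

namespace SkewAt

variable {al be : Module.End ℂ R} {t : ℂ} {a a' b b' : R}

theorem add₁ (hloc : ∀ x y, ∃ N, ∀ n ≥ N, B n x y = 0)
    (h : SkewAt D B al be t a b) (h' : SkewAt D B al be t a' b) :
    SkewAt D B al be t (a + a') b := fun n => by
  simp only [map_add, LinearMap.add_apply, h n, h' n, nsub_add D (hloc _ _) (hloc _ _), smul_add]

theorem add₂ (hloc : ∀ x y, ∃ N, ∀ n ≥ N, B n x y = 0)
    (h : SkewAt D B al be t a b) (h' : SkewAt D B al be t a b') :
    SkewAt D B al be t a (b + b') := fun n => by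
  simp only [map_add, LinearMap.add_apply, h n, h' n, nsub_add D (hloc _ _) (hloc _ _), smul_add]

theorem smul₁ (r : ℂ) (h : SkewAt D B al be t a b) : SkewAt D B al be t (r • a) b := fun n => by
  simp only [map_smul, LinearMap.smul_apply, h n, nsub_smul, smul_comm (-t) r]

theorem smul₂ (r : ℂ) (h : SkewAt D B al be t a b) : SkewAt D B al be t a (r • b) := fun n => by
  simp only [map_smul, LinearMap.smul_apply, h n, nsub_smul, smul_comm (-t) r]

theorem der₁ (hB : IsSesq D B) (hloc : ∀ x y, ∃ N, ∀ n ≥ N, B n x y = 0)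
    (hal : ∀ x, al (D x) = D (al x)) (hbe : ∀ x, be (D x) = D (be x))
    (h : SkewAt D B al be t a b) : SkewAt D B al be t (D a) b := fun n => by
  have hl := hloc (be b) (al a)
  simp only [hal, hbe, hB.left, hB.right]
  rw [nsub_add D (by obtain ⟨N, hN⟩ := hl; exact ⟨N, fun m hm => by rw [hN m hm, map_zero]⟩)
    (prev_eventually_zero hl), nsub_map D hl, nsub_prev D hl]
  cases n with
  | zero => simp [prev]
  | succ n =>
    simp only [prev, h n, smul_add, smul_sub, smul_neg, neg_smul]
    abel

theorem der₂ (hB : IsSesq D B) (hloc : ∀ x y, ∃ N, ∀ n ≥ N, B n x y = 0)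
    (hal : ∀ x, al (D x) = D (al x)) (hbe : ∀ x, be (D x) = D (be x))
    (h : SkewAt D B al be t a b) : SkewAt D B al be t a (D b) := fun n => by
  have hl := hloc (be b) (al a)
  simp only [hal, hbe, hB.left, hB.right]
  rw [nsub_neg, nsub_prev D hl]
  cases n with
  | zero => simp [prev, h 0]
  | succ n =>
    simp only [prev, h n, h (n + 1), map_neg, map_smul, smul_sub, smul_neg, neg_smul]
    abel

end SkewAt

end LambdaProduct

section Affinization

variable {L : Type*} [AddCommGroup L] [Module ℂ L]

/-- The submodule `ℂ[∂] ⊗ U` of `ℂ[∂] ⊗ L`. -/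
abbrev polySpan (U : Submodule ℂ L) : Submodule ℂ (Polynomial ℂ ⊗[ℂ] L) :=
  Submodule.span ℂ {x | ∃ (f : Polynomial ℂ) (u : L), u ∈ U ∧ x = f ⊗ₜ u}

/-- The action of `∂` on `ℂ[∂] ⊗ L`. -/
abbrev polyDer (L : Type*) [AddCommGroup L] [Module ℂ L] : Module.End ℂ (Polynomial ℂ ⊗[ℂ] L) :=
  (LinearMap.mulLeft ℂ (Polynomial.X : Polynomial ℂ)).rTensor L

theorem polySpan_induction {U : Submodule ℂ L} {p : Polynomial ℂ ⊗[ℂ] L → Prop}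
    (base : ∀ u ∈ U, p (1 ⊗ₜ u)) (add : ∀ x y, p x → p y → p (x + y))
    (smul : ∀ (r : ℂ) x, p x → p (r • x)) (der : ∀ x, p x → p (polyDer L x)) :
    ∀ x ∈ polySpan U, p x := by
  intro x hx
  induction hx using Submodule.span_induction with
  | zero => simpa using base 0 U.zero_mem
  | add x y _ _ hx hy => exact add x y hx hy
  | smul r x _ hx => exact smul r x hx
  | mem x hx =>
    obtain ⟨f, u, hu, rfl⟩ := hx
    induction f using Polynomial.induction_on' with
    | add f g hf hg => rw [TensorProduct.add_tmul]; exact add _ _ hf hg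
    | monomial n r =>
      induction n with
      | zero =>
        rw [show Polynomial.monomial 0 r = r • (1 : Polynomial ℂ) by
          rw [Polynomial.smul_eq_C_mul, mul_one]; rfl, ← TensorProduct.smul_tmul']
        exact smul r _ (base u hu)
      | succ n ih =>
        have := der _ ih
        rwa [LinearMap.rTensor_tmul, LinearMap.mulLeft_apply, Polynomial.X_mul_monomial] at this

theorem polySpan_top (L : Type*) [AddCommGroup L] [Module ℂ L] :
    polySpan (⊤ : Submodule ℂ L) = ⊤ := by
  rw [← TensorProduct.span_tmul_eq_top ℂ (Polynomial ℂ) L]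
  simp only [polySpan, Submodule.mem_top, true_and, eq_comm]

theorem poly_tmul_induction {p : Polynomial ℂ ⊗[ℂ] L → Prop}
    (base : ∀ u, p (1 ⊗ₜ u)) (add : ∀ x y, p x → p y → p (x + y))
    (smul : ∀ (r : ℂ) x, p x → p (r • x)) (der : ∀ x, p x → p (polyDer L x))
    (x : Polynomial ℂ ⊗[ℂ] L) : p x :=
  polySpan_induction (U := ⊤) (fun u _ => base u) add smul der x
    (by rw [polySpan_top]; exact Submodule.mem_top)

theorem map_mem_polySpan {U V : Submodule ℂ L} {f : Module.End ℂ (Polynomial ℂ)}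
    {g : Module.End ℂ L} (hg : ∀ u ∈ U, g u ∈ V) {x : Polynomial ℂ ⊗[ℂ] L}
    (hx : x ∈ polySpan U) : TensorProduct.map f g x ∈ polySpan V := by
  induction hx using Submodule.span_induction with
  | zero => simp
  | add x y _ _ hx hy => rw [map_add]; exact add_mem hx hy
  | smul r x _ hx => rw [map_smul]; exact Submodule.smul_mem _ r hx
  | mem x hx =>
    obtain ⟨h, u, hu, rfl⟩ := hx
    exact Submodule.subset_span ⟨f h, g u, hg u hu, rfl⟩

theorem lTensor_polyDer (f : Module.End ℂ L) (x : Polynomial ℂ ⊗[ℂ] L) :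
    f.lTensor (Polynomial ℂ) (polyDer L x) = polyDer L (f.lTensor (Polynomial ℂ) x) := by
  rw [← LinearMap.comp_apply, ← LinearMap.comp_apply, LinearMap.lTensor_comp_rTensor,
    LinearMap.rTensor_comp_lTensor]

theorem isCompl_polySpan {U V : Submodule ℂ L} (h : IsCompl U V) :
    IsCompl (polySpan U) (polySpan V) := by
  have hU : ∀ x ∈ polySpan U, (U.projection V h).lTensor (Polynomial ℂ) x = x := fun x hx => by
    induction hx using Submodule.span_induction with
    | zero => simp
    | add x y _ _ hx hy => rw [map_add, hx, hy]
    | smul r x _ hx => rw [map_smul, hx]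
    | mem x hx =>
      obtain ⟨f, u, hu, rfl⟩ := hx
      rw [LinearMap.lTensor_tmul, Submodule.projection_apply_of_mem_left h hu]
  have hV : ∀ x ∈ polySpan V, (U.projection V h).lTensor (Polynomial ℂ) x = 0 := fun x hx => by
    induction hx using Submodule.span_induction with
    | zero => simp
    | add x y _ _ hx hy => rw [map_add, hx, hy, add_zero]
    | smul r x _ hx => rw [map_smul, hx, smul_zero]
    | mem x hx =>
      obtain ⟨f, u, hu, rfl⟩ := hx
      rw [LinearMap.lTensor_tmul, (Submodule.projection_apply_eq_zero_iff h).2 hu,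
        TensorProduct.tmul_zero]
  refine ⟨Submodule.disjoint_def.2 fun x hx hx' => by rw [← hU x hx, hV x hx'], ?_⟩
  rw [codisjoint_iff, eq_top_iff, ← polySpan_top, Submodule.span_le]
  rintro _ ⟨f, u, -, rfl⟩
  obtain ⟨v, hv, w, hw, rfl⟩ := Submodule.mem_sup.1 (h.sup_eq_top ▸ Submodule.mem_top (x := u))
  rw [TensorProduct.tmul_add]
  exact Submodule.add_mem_sup (Submodule.subset_span ⟨f, v, hv, rfl⟩)
    (Submodule.subset_span ⟨f, w, hw, rfl⟩)

theorem isInternal_polySpan {G : ZMod 2 → Submodule ℂ L} (h : DirectSum.IsInternal G) :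
    DirectSum.IsInternal fun i => polySpan (G i) := by
  have h01 : (0 : ZMod 2) ≠ 1 := by decide
  have huniv : (Set.univ : Set (ZMod 2)) = {0, 1} := by
    symm
    rw [Set.eq_univ_iff_forall]
    decide +revert
  rw [DirectSum.isInternal_submodule_iff_isCompl _ h01 huniv] at h ⊢
  exact isCompl_polySpan h

end Affinization

/-- Let `(L, [·,·], α, β)` be a BiHom-Lie superalgebra. Then the free
ℤ₂-graded `ℂ[∂]`-module `R = ℂ[∂] ⊗ L`, with λ-bracket determined by `[u_λ v] = [u, v]`
for `u, v ∈ L` (i.e. `br' 0 (1 ⊗ u) (1 ⊗ v) = 1 ⊗ [u,v]` and the higher coefficients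
vanish), extended by conformal sesquilinearity
(`[(∂x)_λ y] = −λ[x_λ y]`, `[x_λ (∂y)] = (∂+λ)[x_λ y]`), and with
`α(f(∂) ⊗ u) = f(∂) ⊗ α(u)`, `β(f(∂) ⊗ u) = f(∂) ⊗ β(u)`, is a BiHom-Lie conformal
superalgebra. -/
theorem affinization_isBiHomLieConfSuperAlg {L : Type*} [AddCommGroup L] [Module ℂ L]
    (Gsup : ZMod 2 → Submodule ℂ L) (bkt : L → L → L) (alL beL : Module.End ℂ L)
    (hL : IsBiHomLieSuperAlg Gsup bkt alL beL)
    (br' : ℕ → Polynomial ℂ ⊗[ℂ] L → Polynomial ℂ ⊗[ℂ] L → Polynomial ℂ ⊗[ℂ] L)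
    (hbil : IsBil br')
    (hbr0 : ∀ (u v : L),
      br' 0 ((1 : Polynomial ℂ) ⊗ₜ u) ((1 : Polynomial ℂ) ⊗ₜ v)
        = (1 : Polynomial ℂ) ⊗ₜ bkt u v)
    (hbrn : ∀ (n : ℕ), 0 < n → ∀ (u v : L),
      br' n ((1 : Polynomial ℂ) ⊗ₜ u) ((1 : Polynomial ℂ) ⊗ₜ v) = 0)
    (hsesq₁ : ∀ (n : ℕ) (x y : Polynomial ℂ ⊗[ℂ] L),
      br' n (((LinearMap.mulLeft ℂ (Polynomial.X : Polynomial ℂ)).rTensor L) x) y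
        = - prev (fun m => br' m x y) n)
    (hsesq₂ : ∀ (n : ℕ) (x y : Polynomial ℂ ⊗[ℂ] L),
      br' n x (((LinearMap.mulLeft ℂ (Polynomial.X : Polynomial ℂ)).rTensor L) y)
        = ((LinearMap.mulLeft ℂ (Polynomial.X : Polynomial ℂ)).rTensor L) (br' n x y)
          + prev (fun m => br' m x y) n) :
    IsBiHomLieConfSuperAlg
      (fun θ => Submodule.span ℂ
        {x : Polynomial ℂ ⊗[ℂ] L | ∃ (f : Polynomial ℂ) (u : L), u ∈ Gsup θ ∧ x = f ⊗ₜ u})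
      ((LinearMap.mulLeft ℂ (Polynomial.X : Polynomial ℂ)).rTensor L)
      (alL.lTensor (Polynomial ℂ)) (beL.lTensor (Polynomial ℂ)) br' := by
  obtain ⟨B, rfl⟩ : ∃ B : ℕ → (Polynomial ℂ ⊗[ℂ] L) →ₗ[ℂ] (Polynomial ℂ ⊗[ℂ] L) →ₗ[ℂ]
      (Polynomial ℂ ⊗[ℂ] L), br' = fun n x y => B n x y :=
    ⟨fun n => LinearMap.mk₂ ℂ (br' n) (hbil.add_left n) (hbil.smul_left n) (hbil.add_right n)
      (hbil.smul_right n), rfl⟩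
  beta_reduce at hbr0 hbrn
  have hB : IsSesq (polyDer L) B := ⟨hsesq₁, hsesq₂⟩
  have hal := lTensor_polyDer alL
  have hbe := lTensor_polyDer beL
  have hder : ∀ (i : ZMod 2), ∀ x ∈ polySpan (Gsup i), polyDer L x ∈ polySpan (Gsup i) :=
    fun i x hx => map_mem_polySpan (fun u hu => hu) hx
  have hprev : ∀ (V : Submodule ℂ (Polynomial ℂ ⊗[ℂ] L)) (g : ℕ → Polynomial ℂ ⊗[ℂ] L),
      (∀ n, g n ∈ V) → ∀ n, prev g n ∈ V := fun V g hg n => by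
    cases n
    exacts [V.zero_mem, hg _]
  have hloc : ∀ x y, ∃ N, ∀ n ≥ N, B n x y = 0 := by
    refine poly_tmul_induction (fun u => poly_tmul_induction (fun v => ?_) ?_ ?_ ?_) ?_ ?_ ?_
    · exact ⟨1, fun n hn => hbrn n hn u v⟩
    · rintro x y ⟨N, hN⟩ ⟨K, hK⟩
      exact ⟨max N K, fun n hn => by
        rw [map_add, hN n (le_trans (le_max_left _ _) hn), hK n (le_trans (le_max_right _ _) hn),
          add_zero]⟩
    · rintro r x ⟨N, hN⟩
      exact ⟨N, fun n hn => by rw [map_smul, hN n hn, smul_zero]⟩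
    · rintro x hx
      obtain ⟨K, hK⟩ := prev_eventually_zero hx
      obtain ⟨N, hN⟩ := hx
      exact ⟨max N K, fun n hn => by
        rw [hB.right, hN n (le_trans (le_max_left _ _) hn),
          hK n (le_trans (le_max_right _ _) hn), map_zero, add_zero]⟩
    · intro x y hx hy z
      obtain ⟨N, hN⟩ := hx z
      obtain ⟨K, hK⟩ := hy z
      exact ⟨max N K, fun n hn => by
        rw [map_add, LinearMap.add_apply, hN n (le_trans (le_max_left _ _) hn),
          hK n (le_trans (le_max_right _ _) hn), add_zero]⟩
    · intro r x hx z
      obtain ⟨N, hN⟩ := hx z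
      exact ⟨N, fun n hn => by rw [map_smul, LinearMap.smul_apply, hN n hn, smul_zero]⟩
    · intro x hx z
      obtain ⟨N, hN⟩ := prev_eventually_zero (hx z)
      exact ⟨N, fun n hn => by rw [hB.left, hN n hn, neg_zero]⟩
  have hpres : ∀ f : Module.End ℂ L, (∀ u v, f (bkt u v) = bkt (f u) (f v)) → ∀ x y n,
      f.lTensor (Polynomial ℂ) (B n x y) =
        B n (f.lTensor (Polynomial ℂ) x) (f.lTensor (Polynomial ℂ) y) := by
    intro f hf
    have hfD := lTensor_polyDer f
    refine poly_tmul_induction (fun u => poly_tmul_induction (fun v n => ?_) ?_ ?_ ?_) ?_ ?_ ?_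
    · rcases Nat.eq_zero_or_pos n with rfl | hn
      · simp [hbr0, hf]
      · simp [hbrn n hn]
    · intro x y hx hy n
      simp only [map_add, hx n, hy n]
    · intro r x hx n
      simp only [map_smul, hx n]
    · intro x hx n
      simp only [hB.right, map_add, hfD, map_prev, hx]
    · intro x y hx hy z n
      simp only [map_add, LinearMap.add_apply, hx z n, hy z n]
    · intro r x hx z n
      simp only [map_smul, LinearMap.smul_apply, hx z n]
    · intro x hx z n
      simp only [hB.left, map_neg, hfD, map_prev, hx z]
  have hgrade : ∀ i j, ∀ x ∈ polySpan (Gsup i), ∀ y ∈ polySpan (Gsup j), ∀ n,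
      B n x y ∈ polySpan (Gsup (i + j)) := by
    intro i j
    refine polySpan_induction (fun u hu =>
      polySpan_induction (fun v hv n => ?_) ?_ ?_ ?_) ?_ ?_ ?_
    · rcases Nat.eq_zero_or_pos n with rfl | hn
      · exact (hbr0 u v).symm ▸ Submodule.subset_span ⟨1, _, hL.grade i j u v hu hv, rfl⟩
      · exact (hbrn n hn u v).symm ▸ Submodule.zero_mem _
    · intro x y hx hy n
      rw [map_add]
      exact add_mem (hx n) (hy n)
    · intro r x hx n
      rw [map_smul]
      exact Submodule.smul_mem _ r (hx n)
    · intro x hx n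
      rw [hB.right]
      exact add_mem (hder _ _ (hx n)) (hprev _ _ hx n)
    · intro x y hx hy z hz n
      rw [map_add]
      exact add_mem (hx z hz n) (hy z hz n)
    · intro r x hx z hz n
      rw [map_smul]
      exact Submodule.smul_mem _ r (hx z hz n)
    · intro x hx z hz n
      rw [hB.left]
      exact neg_mem (hprev _ _ (hx z hz) n)
  have hskew : ∀ i j, ∀ x ∈ polySpan (Gsup i), ∀ y ∈ polySpan (Gsup j),
      SkewAt (polyDer L) B (alL.lTensor (Polynomial ℂ)) (beL.lTensor (Polynomial ℂ)) (sgn i j)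
        x y := by
    intro i j
    refine polySpan_induction (fun u hu =>
      polySpan_induction (fun v hv n => ?_) (fun _ _ => SkewAt.add₂ hloc)
        (fun r _ => SkewAt.smul₂ r) (fun _ => SkewAt.der₂ hB hloc hal hbe))
      (fun _ _ h h' y hy => (h y hy).add₁ hloc (h' y hy)) (fun r _ h y hy => (h y hy).smul₁ r)
      (fun _ h y hy => (h y hy).der₁ hB hloc hal hbe)
    simp only [LinearMap.lTensor_tmul]
    rw [nsub_eq_sum_range _ (N := 1) (fun m hm => hbrn m hm _ _) n le_rfl, sum_range_one]
    rcases Nat.eq_zero_or_pos n with rfl | hn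
    · simp [hbr0, hL.skew i j u v hu hv, TensorProduct.tmul_neg]
    · simp [hbrn n hn]
  have hjac : ∀ i j, ∀ x ∈ polySpan (Gsup i), ∀ y ∈ polySpan (Gsup j), ∀ z,
      JacobiAt B (alL.lTensor (Polynomial ℂ)) (beL.lTensor (Polynomial ℂ)) (sgn i j)
        x y z := by
    intro i j
    refine polySpan_induction (fun u hu =>
      polySpan_induction (fun v hv => poly_tmul_induction (fun w m n => ?_)
        (fun _ _ => JacobiAt.add₃) (fun r _ => JacobiAt.smul₃ r)
        (fun _ => JacobiAt.der₃ hB hbe))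
        (fun _ _ h h' z => (h z).add₂ (h' z)) (fun r _ h z => (h z).smul₂ r)
        (fun _ h z => (h z).der₂ hB hbe))
      (fun _ _ h h' y hy z => (h y hy z).add₁ (h' y hy z))
      (fun r _ h y hy z => (h y hy z).smul₁ r)
      (fun _ h y hy z => (h y hy z).der₁ hB hal hbe)
    have hbase : ∀ n u v, B n (1 ⊗ₜ u) (1 ⊗ₜ v) =
        if n = 0 then (1 : Polynomial ℂ) ⊗ₜ[ℂ] bkt u v else 0 := fun n u v => by
      split_ifs with hn
      · exact hn ▸ hbr0 u v
      · exact hbrn n (Nat.pos_of_ne_zero hn) u v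
    simp only [LinearMap.lTensor_tmul]
    by_cases h : m = 0 ∧ n = 0
    · obtain ⟨rfl, rfl⟩ := h
      simp [shiftCoeff, hbase, hL.jacobi i j u v w hu hv, TensorProduct.tmul_add]
    · have hs : shiftCoeff (fun l k => B l (B k (1 ⊗ₜ beL u) (1 ⊗ₜ v)) (1 ⊗ₜ beL w)) m n = 0 := by
        refine sum_eq_zero fun s hs => ?_
        have := mem_range.1 hs
        by_cases hk : m - s = 0
        · simp only [hbase, hk, if_true, if_neg (show n + s ≠ 0 by omega), smul_zero]
        · simp [hbase, hk]
      rw [hs, hbase n, hbase m]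
      by_cases hm : m = 0
      · have hn : n ≠ 0 := fun hn => h ⟨hm, hn⟩
        simp [hm, hn, hbase]
      · by_cases hn : n = 0 <;> simp [hm, hn, hbase]
  exact
    { internal := isInternal_polySpan hL.internal
      der_even := hder
      al_even := fun i _ hx => map_mem_polySpan (hL.al_even i) hx
      be_even := fun i _ hx => map_mem_polySpan (hL.be_even i) hx
      al_be_comm := fun x => by
        rw [← LinearMap.comp_apply, ← LinearMap.comp_apply, ← LinearMap.lTensor_comp,
          ← LinearMap.lTensor_comp, show alL ∘ₗ beL = beL ∘ₗ alL from LinearMap.ext hL.al_be_comm]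
      al_der := hal
      be_der := hbe
      bil := hbil
      grade := fun i j n x y hx hy => hgrade i j x hx y hy n
      locality := hloc
      al_br := fun n x y => hpres alL hL.al_bkt x y n
      be_br := fun n x y => hpres beL hL.be_bkt x y n
      sesq₁ := hsesq₁
      sesq₂ := hsesq₂
      skew := fun i j n x y hx hy => hskew i j x hx y hy n
      jacobi := fun i j m n x y z hx hy => hjac i j x hx y hy z m n }
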